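/- Let A be a commutative noetherian ring that is regular (every finitely generated A-module has finite projective dimension) and has infinite Krull dimension, and let Ã = [[A,0],[S̄,Ā]] be its asymmetric cover. Then fin.dim Ã = ∞ and fin.dim Ã^op = 0. -/

import Mathlib

set_option linter.unusedSectionVars false
set_option synthInstance.maxHeartbeats 1000000
set_option maxHeartbeats 1600000
set_option linter.unusedVariables false
set_option linter.unnecessarySeqFocus false

universe u
open MulOpposite Function DirectSum

/-! ### Lower triangular matrix rings -/

/-- The lower triangular matrix ring `[[A,0],[M,B]]` for a `B`-`A`-bimodule `M`
(a left `B`-module with a commuting right `A`-action, the latter written as a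
left `Aᵐᵒᵖ`-action). The element `⟨a, m, b⟩` represents the matrix `[[a,0],[m,b]]`. -/
@[ext] structure Tri (A B M : Type u) : Type u where
  a : A
  m : M
  b : B

namespace Tri
variable {A B M : Type u} [Ring A] [Ring B] [AddCommGroup M]
  [Module B M] [Module Aᵐᵒᵖ M] [SMulCommClass B Aᵐᵒᵖ M]

instance : Zero (Tri A B M) := ⟨⟨0, 0, 0⟩⟩
instance : Add (Tri A B M) := ⟨fun x y => ⟨x.a + y.a, x.m + y.m, x.b + y.b⟩⟩
instance : Neg (Tri A B M) := ⟨fun x => ⟨-x.a, -x.m, -x.b⟩⟩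
instance : One (Tri A B M) := ⟨⟨1, 0, 1⟩⟩
instance : Mul (Tri A B M) :=
  ⟨fun x y => ⟨x.a * y.a, op y.a • x.m + x.b • y.m, x.b * y.b⟩⟩

@[simp] lemma zero_a : (0 : Tri A B M).a = 0 := rfl
@[simp] lemma zero_m : (0 : Tri A B M).m = 0 := rfl
@[simp] lemma zero_b : (0 : Tri A B M).b = 0 := rfl
@[simp] lemma add_a (x y : Tri A B M) : (x + y).a = x.a + y.a := rfl
@[simp] lemma add_m (x y : Tri A B M) : (x + y).m = x.m + y.m := rfl
@[simp] lemma add_b (x y : Tri A B M) : (x + y).b = x.b + y.b := rfl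
@[simp] lemma neg_a (x : Tri A B M) : (-x).a = -x.a := rfl
@[simp] lemma neg_m (x : Tri A B M) : (-x).m = -x.m := rfl
@[simp] lemma neg_b (x : Tri A B M) : (-x).b = -x.b := rfl
@[simp] lemma one_a : (1 : Tri A B M).a = 1 := rfl
@[simp] lemma one_m : (1 : Tri A B M).m = 0 := rfl
@[simp] lemma one_b : (1 : Tri A B M).b = 1 := rfl
@[simp] lemma mul_a (x y : Tri A B M) : (x * y).a = x.a * y.a := rfl
@[simp] lemma mul_m (x y : Tri A B M) : (x * y).m = op y.a • x.m + x.b • y.m := rfl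
@[simp] lemma mul_b (x y : Tri A B M) : (x * y).b = x.b * y.b := rfl

instance : AddCommGroup (Tri A B M) where
  add_assoc x y z := by ext <;> simp [add_assoc]
  zero_add x := by ext <;> simp
  add_zero x := by ext <;> simp
  add_comm x y := by ext <;> simp [add_comm]
  neg_add_cancel x := by ext <;> simp
  nsmul := nsmulRec
  zsmul := zsmulRec

instance : Ring (Tri A B M) :=
  { (inferInstance : AddCommGroup (Tri A B M)),
    (inferInstance : Mul (Tri A B M)),
    (inferInstance : One (Tri A B M)) with
    left_distrib := fun x y z => by
      ext <;> simp [mul_add, smul_add, add_smul] <;> abel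
    right_distrib := fun x y z => by
      ext <;> simp [add_mul, smul_add, add_smul] <;> abel
    zero_mul := fun x => by ext <;> simp
    mul_zero := fun x => by ext <;> simp
    mul_assoc := fun x y z => by
      refine Tri.ext (mul_assoc _ _ _) ?_ (mul_assoc _ _ _)
      simp only [mul_m, mul_b, mul_a, smul_add, op_mul, mul_smul]
      rw [smul_comm x.b (op z.a) y.m]
      abel
    one_mul := fun x => by ext <;> simp
    mul_one := fun x => by ext <;> simp }

end Tri

/-! ### Corner rings -/

/-- The corner ring `eΛe` of a ring `Λ` at an idempotent `e`, with unit `e`. -/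
def Corner {Λ : Type u} [Ring Λ] (e : Λ) (_ : IsIdempotentElem e) : Type u :=
  {x : Λ // e * x = x ∧ x * e = x}

namespace Corner
variable {Λ : Type u} [Ring Λ] {e : Λ} {he : IsIdempotentElem e}

instance : Zero (Corner e he) := ⟨⟨0, by simp, by simp⟩⟩
instance : Add (Corner e he) :=
  ⟨fun x y => ⟨x.1 + y.1, by rw [mul_add, x.2.1, y.2.1], by rw [add_mul, x.2.2, y.2.2]⟩⟩
instance : Neg (Corner e he) :=
  ⟨fun x => ⟨-x.1, by rw [mul_neg, x.2.1], by rw [neg_mul, x.2.2]⟩⟩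
instance : Mul (Corner e he) :=
  ⟨fun x y => ⟨x.1 * y.1, by rw [← mul_assoc, x.2.1], by rw [mul_assoc, y.2.2]⟩⟩
instance : One (Corner e he) := ⟨⟨e, he, he⟩⟩

instance : Ring (Corner e he) where
  add_assoc x y z := Subtype.ext (add_assoc _ _ _)
  zero_add x := Subtype.ext (zero_add _)
  add_zero x := Subtype.ext (add_zero _)
  add_comm x y := Subtype.ext (add_comm _ _)
  neg_add_cancel x := Subtype.ext (neg_add_cancel _)
  nsmul := nsmulRec
  zsmul := zsmulRec
  left_distrib x y z := Subtype.ext (mul_add _ _ _)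
  right_distrib x y z := Subtype.ext (add_mul _ _ _)
  zero_mul x := Subtype.ext (zero_mul _)
  mul_zero x := Subtype.ext (mul_zero _)
  mul_assoc x y z := Subtype.ext (mul_assoc _ _ _)
  one_mul x := Subtype.ext x.2.1
  mul_one x := Subtype.ext x.2.2

end Corner

/-! ### Projective dimension and finitistic dimensions -/

/-- `pdLE R n M` : `M` has projective dimension at most `n` as a left `R`-module. -/
def pdLE (R : Type u) [Ring R] : (n : ℕ) → (M : Type u) → [AddCommGroup M] → [Module R M] → Prop
  | 0, M, _, _ => Module.Projective R M
  | n+1, M, _, _ => ∃ (P : Type u) (_ : AddCommGroup P) (_ : Module R P),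
      Module.Projective R P ∧
      ∃ f : P →ₗ[R] M, Function.Surjective f ∧ pdLE R n (LinearMap.ker f)

/-- The projective dimension of a left `R`-module, as an element of `ℕ∞`
(with value `⊤` when no finite projective resolution exists). -/
noncomputable def projDim (R : Type u) [Ring R] (M : Type u) [AddCommGroup M] [Module R M] : ℕ∞ :=
  sInf {d : ℕ∞ | ∃ n : ℕ, d = n ∧ pdLE R n M}

/-- `fgpdLE R n M` : `M` admits a resolution of length at most `n` by finitely
generated projective left `R`-modules. -/
def fgpdLE (R : Type u) [Ring R] :
    (n : ℕ) → (M : Type u) → [AddCommGroup M] → [Module R M] → Prop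
  | 0, M, _, _ => Module.Projective R M ∧ Module.Finite R M
  | n+1, M, _, _ => ∃ (P : Type u) (_ : AddCommGroup P) (_ : Module R P),
      (Module.Projective R P ∧ Module.Finite R P) ∧
      ∃ f : P →ₗ[R] M, Function.Surjective f ∧ fgpdLE R n (LinearMap.ker f)

/-- The small finitistic dimension of `R`, computed with *left* `R`-modules: the
supremum of the projective dimensions of the left modules admitting a finite
resolution by finitely generated projectives. -/
noncomputable def smallFinDimLeft (R : Type u) [Ring R] : ℕ∞ :=
  sSup {d : ℕ∞ | ∃ (M : Type u) (_ : AddCommGroup M) (_ : Module R M),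
    (∃ n : ℕ, fgpdLE R n M) ∧ projDim R M = d}

/-- The big finitistic dimension of `R`, computed with *left* `R`-modules: the
supremum of all finite projective dimensions of left `R`-modules. -/
noncomputable def bigFinDimLeft (R : Type u) [Ring R] : ℕ∞ :=
  sSup {d : ℕ∞ | d ≠ ⊤ ∧ ∃ (M : Type u) (_ : AddCommGroup M) (_ : Module R M),
    projDim R M = d}

/-- `fin.dim R` : the small finitistic dimension of `R`, computed with right
`R`-modules (= left `Rᵐᵒᵖ`-modules). -/
noncomputable def finDim (R : Type u) [Ring R] : ℕ∞ := smallFinDimLeft Rᵐᵒᵖ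

/-- `Fin.dim R` : the big finitistic dimension of `R`, computed with right
`R`-modules (= left `Rᵐᵒᵖ`-modules). -/
noncomputable def bigFinDim (R : Type u) [Ring R] : ℕ∞ := bigFinDimLeft Rᵐᵒᵖ

/-! ### Radical, socle, perfect and semilocal rings, Morita equivalence -/

/-- The radical of a module: the intersection of all maximal submodules. -/
def moduleRad (R M : Type u) [Ring R] [AddCommGroup M] [Module R M] : Submodule R M :=
  sInf {N : Submodule R M | IsCoatom N}

/-- The socle of a module: the sum of all simple submodules. -/
def moduleSoc (R M : Type u) [Ring R] [AddCommGroup M] [Module R M] : Submodule R M :=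
  sSup {N : Submodule R M | IsSimpleModule R ↥N}

/-- A ring is right perfect if every right module has a projective cover,
i.e. a superfluous epimorphism from a projective module. -/
def IsRightPerfect (R : Type u) [Ring R] : Prop :=
  ∀ (M : Type u) (_ : AddCommGroup M) (_ : Module Rᵐᵒᵖ M),
    ∃ (P : Type u) (_ : AddCommGroup P) (_ : Module Rᵐᵒᵖ P) (f : P →ₗ[Rᵐᵒᵖ] M),
      Module.Projective Rᵐᵒᵖ P ∧ Function.Surjective f ∧
      ∀ N : Submodule Rᵐᵒᵖ P, N ⊔ LinearMap.ker f = ⊤ → N = ⊤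

/-- A ring is left perfect if every left module has a projective cover. -/
def IsLeftPerfect (R : Type u) [Ring R] : Prop :=
  ∀ (M : Type u) (_ : AddCommGroup M) (_ : Module R M),
    ∃ (P : Type u) (_ : AddCommGroup P) (_ : Module R P) (f : P →ₗ[R] M),
      Module.Projective R P ∧ Function.Surjective f ∧
      ∀ N : Submodule R P, N ⊔ LinearMap.ker f = ⊤ → N = ⊤

/-- A ring is semilocal if its quotient by the Jacobson radical is semisimple;
equivalently, there is a surjective ring homomorphism onto a semisimple ring
whose kernel is the Jacobson radical. -/
def IsSemilocal (A : Type u) [Ring A] : Prop :=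
  ∃ (T : Type u) (_ : Ring T) (f : A →+* T), Function.Surjective f ∧
    IsSemisimpleRing T ∧ RingHom.ker f = (⊥ : Ideal A).jacobson

/-- Morita equivalence, via the categories of right modules. -/
def MoritaEquiv (R S : Type u) [Ring R] [Ring S] : Prop :=
  Nonempty (ModuleCat.{u} Rᵐᵒᵖ ≌ ModuleCat.{u} Sᵐᵒᵖ)

/-- Powers of an additive subgroup of a ring (e.g. of the Jacobson radical of a
not necessarily commutative ring), defined via products. -/
def addSubgroupPow {R : Type u} [Ring R] (I : AddSubgroup R) : ℕ → AddSubgroup R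
  | 0 => ⊤
  | 1 => I
  | n+2 => AddSubgroup.closure {x : R | ∃ p ∈ I, ∃ q ∈ addSubgroupPow I (n+1), x = p * q}

/-- Left multiplication by a fixed element, as an endomorphism of the right
regular module. -/
def leftMulHom (R : Type u) [Ring R] (z : R) : R →ₗ[Rᵐᵒᵖ] R where
  toFun x := z * x
  map_add' := mul_add z
  map_smul' r x := (mul_assoc z x r.unop).symm

/-! ### The asymmetric cover -/

/-- The endomorphism ring of the right `A`-module `S i`. -/
abbrev EndS (A : Type u) [Ring A] {ι : Type u} (S : ι → Type u)
    [∀ i, AddCommGroup (S i)] [∀ i, Module Aᵐᵒᵖ (S i)] (i : ι) : Type u :=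
  Module.End Aᵐᵒᵖ (S i)

/-- `Ā = ∏_{S ∈ Σ(A)} T(End_A(S))`, the product over the simple right `A`-modules
of the trivial extensions of their endomorphism rings. -/
abbrev Abar (A : Type u) [Ring A] {ι : Type u} (S : ι → Type u)
    [∀ i, AddCommGroup (S i)] [∀ i, Module Aᵐᵒᵖ (S i)] : Type u :=
  ∀ i, TrivSqZeroExt (EndS A S i) (EndS A S i)

/-- `S̄ = ⊕_{S ∈ Σ(A)} S`, the direct sum of the simple right `A`-modules. -/
abbrev Sbar (A : Type u) [Ring A] {ι : Type u} (S : ι → Type u)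
    [∀ i, AddCommGroup (S i)] [∀ i, Module Aᵐᵒᵖ (S i)] : Type u :=
  ⨁ i, S i

/-- The canonical projection `T(B) → B` from a trivial extension, as a ring
homomorphism. -/
def tszeFst (B : Type u) [Ring B] : TrivSqZeroExt B B →+* B where
  toFun x := x.fst
  map_one' := rfl
  map_mul' _ _ := rfl
  map_zero' := rfl
  map_add' _ _ := rfl

section
variable (A : Type u) [Ring A] {ι : Type u} (S : ι → Type u)
  [∀ i, AddCommGroup (S i)] [∀ i, Module Aᵐᵒᵖ (S i)]

/-- The left `Ā`-action on each simple module `S i`, via `Ā → T(End_A(S i)) → End_A(S i)`. -/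
instance instModuleAbarS (i : ι) : Module (Abar A S) (S i) where
  smul r x := (r i).fst x
  one_smul x := rfl
  mul_smul r s x := rfl
  smul_zero r := map_zero _
  smul_add r x y := map_add _ x y
  add_smul r s x := LinearMap.add_apply _ _ _
  zero_smul x := rfl

lemma abar_smul_def (r : Abar A S) (i : ι) (x : S i) : r • x = (r i).fst x := rfl

instance instSMulCommAbarS (i : ι) : SMulCommClass (Abar A S) Aᵐᵒᵖ (S i) where
  smul_comm r a x := map_smul ((r i).fst) a x

instance instSMulCommAbarSbar : SMulCommClass (Abar A S) Aᵐᵒᵖ (Sbar A S) where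
  smul_comm r a x := by
    refine DFinsupp.ext fun i => ?_
    simp only [DirectSum.smul_apply]
    exact smul_comm _ _ _

end

/-- The asymmetric cover `Ã = [[A,0],[S̄,Ā]]` of the ring `A`, relative to a
family `S : ι → Type u` of representatives of the simple right `A`-modules. -/
abbrev AsymCover (A : Type u) [Ring A] {ι : Type u} (S : ι → Type u)
    [∀ i, AddCommGroup (S i)] [∀ i, Module Aᵐᵒᵖ (S i)] : Type u :=
  Tri A (Abar A S) (Sbar A S)

/-- `S : ι → Type u` is a complete irredundant family of representatives of the
isomorphism classes of simple right `A`-modules. -/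
def IsSimpleFamily (A : Type u) [Ring A] {ι : Type u} (S : ι → Type u)
    [∀ i, AddCommGroup (S i)] [∀ i, Module Aᵐᵒᵖ (S i)] : Prop :=
  (∀ i, IsSimpleModule Aᵐᵒᵖ (S i)) ∧
  (∀ (T : Type u) (_ : AddCommGroup T) (_ : Module Aᵐᵒᵖ T),
    IsSimpleModule Aᵐᵒᵖ T → ∃ i, Nonempty (T ≃ₗ[Aᵐᵒᵖ] S i)) ∧
  (∀ i j, Nonempty (S i ≃ₗ[Aᵐᵒᵖ] S j) → i = j)


open CategoryTheory in
theorem pdLE_iff_hasProjectiveDimensionLE (R : Type u) [Ring R] (n : ℕ) (M : Type u)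
    [AddCommGroup M] [Module R M] :
    pdLE R n M ↔ HasProjectiveDimensionLE (ModuleCat.of R M) n := by
  induction n generalizing M with
  | zero =>
    rw [← projective_iff_hasProjectiveDimensionLE_zero, ← IsProjective.iff_projective]
    rfl
  | succ n ih =>
    constructor
    · rintro ⟨P, _, _, hP, f, hf, hk⟩
      have hS := LinearMap.shortExact_shortComplexKer hf
      have : Projective (f.shortComplexKer).X₂ := (IsProjective.iff_projective P).1 hP
      exact (hS.hasProjectiveDimensionLT_X₃_iff n this).2 ((ih _).1 hk)
    · intro h
      let f : (M →₀ R) →ₗ[R] M := Finsupp.linearCombination R id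
      have hf : Function.Surjective f := Finsupp.linearCombination_id_surjective R M
      have hS := LinearMap.shortExact_shortComplexKer hf
      have : Projective (f.shortComplexKer).X₂ :=
        (IsProjective.iff_projective (M →₀ R)).1 inferInstance
      exact ⟨M →₀ R, _, _, inferInstance, f, hf,
        (ih _).2 ((hS.hasProjectiveDimensionLT_X₃_iff n this).1 h)⟩

theorem pdLE_mono {R : Type u} [Ring R] {m n : ℕ} (h : m ≤ n) {M : Type u}
    [AddCommGroup M] [Module R M] (hM : pdLE R m M) : pdLE R n M := by
  rw [pdLE_iff_hasProjectiveDimensionLE] at hM ⊢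
  exact CategoryTheory.hasProjectiveDimensionLT_of_ge _ (m + 1) (n + 1) (by lia)

theorem pdLE_ker {R : Type u} [Ring R] {n : ℕ} {M P : Type u} [AddCommGroup M] [Module R M]
    [AddCommGroup P] [Module R P] [Module.Projective R P] (f : P →ₗ[R] M)
    (hf : Function.Surjective f) (hM : pdLE R (n + 1) M) : pdLE R n (LinearMap.ker f) := by
  rw [pdLE_iff_hasProjectiveDimensionLE] at hM ⊢
  have hS := LinearMap.shortExact_shortComplexKer hf
  have : CategoryTheory.Projective (f.shortComplexKer).X₂ :=
    (IsProjective.iff_projective P).1 inferInstance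
  exact (hS.hasProjectiveDimensionLT_X₃_iff n this).1 hM

theorem projDim_le_iff {R : Type u} [Ring R] {n : ℕ} {M : Type u} [AddCommGroup M] [Module R M] :
    projDim R M ≤ n ↔ pdLE R n M := by
  constructor
  · intro h
    have hne : {d : ℕ∞ | ∃ n : ℕ, d = n ∧ pdLE R n M}.Nonempty := by
      by_contra hempty
      rw [Set.not_nonempty_iff_eq_empty] at hempty
      rw [projDim, hempty, sInf_empty] at h
      simp at h
    obtain ⟨m, hm, hM⟩ := csInf_mem hne
    change projDim R M = m at hm
    rw [hm] at h
    exact pdLE_mono (by exact_mod_cast h) hM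
  · exact fun h => sInf_le ⟨n, rfl, h⟩

theorem exists_pdLE_of_projDim_ne_top {R : Type u} [Ring R] {M : Type u} [AddCommGroup M]
    [Module R M] (h : projDim R M ≠ ⊤) : ∃ n : ℕ, pdLE R n M := by
  obtain ⟨n, hn⟩ := ENat.ne_top_iff_exists.1 h
  exact ⟨n, projDim_le_iff.1 hn.ge⟩

theorem fgpdLE_of_pdLE {R : Type u} [Ring R] [IsNoetherianRing R] {n : ℕ} {M : Type u}
    [AddCommGroup M] [Module R M] [Module.Finite R M] (h : pdLE R n M) : fgpdLE R n M := by
  induction n generalizing M with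
  | zero => exact ⟨h, inferInstance⟩
  | succ n ih =>
    obtain ⟨k, f, hf⟩ := Module.Finite.exists_fin' R M
    let g : (ULift.{u} (Fin k) → R) →ₗ[R] M :=
      f ∘ₗ (LinearEquiv.funCongrLeft R R Equiv.ulift.symm).toLinearMap
    have hg : Function.Surjective g := hf.comp (LinearEquiv.surjective _)
    exact ⟨_, _, _, ⟨inferInstance, inferInstance⟩, g, hg, ih (pdLE_ker g hg h)⟩

theorem fgpdLE.finite {R : Type u} [Ring R] {n : ℕ} {M : Type u} [AddCommGroup M] [Module R M]
    (h : fgpdLE R n M) : Module.Finite R M := by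
  cases n with
  | zero => exact h.2
  | succ n =>
    obtain ⟨P, _, _, ⟨-, _⟩, f, hf, -⟩ := h
    exact Module.Finite.of_surjective f hf

section RestrictScalars

variable {R A : Type u} [Ring R] [Ring A] (φ : R →+* A)

/-- An `A`-linear map, viewed as linear over a ring acting through `φ`. -/
def restrictAlong {M N : Type u} [AddCommGroup M] [Module R M] [Module A M]
    [AddCommGroup N] [Module R N] [Module A N]
    (hM : ∀ (r : R) (x : M), r • x = φ r • x) (hN : ∀ (r : R) (x : N), r • x = φ r • x)
    (f : M →ₗ[A] N) : M →ₗ[R] N where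
  toFun := f
  map_add' := map_add f
  map_smul' r x := by rw [RingHom.id_apply, hM, hN, map_smul]

theorem finsupp_smul_eq [Module R A] (hA : ∀ (r : R) (a : A), r • a = φ r * a) (ι : Type u)
    (r : R) (x : ι →₀ A) : r • x = φ r • x :=
  Finsupp.ext fun _ => hA _ _

theorem projective_finsupp [Module R A] [Module.Projective R A] (ι : Type u) :
    Module.Projective R (ι →₀ A) := by
  classical
  exact Module.Projective.of_equiv (finsuppLequivDFinsupp R (ι := ι) (M := A)).symm

theorem projective_of_ringHom [Module R A] [Module.Projective R A]
    (hA : ∀ (r : R) (a : A), r • a = φ r * a)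
    {M : Type u} [AddCommGroup M] [Module R M] [Module A M]
    (hM : ∀ (r : R) (x : M), r • x = φ r • x)
    [Module.Projective A M] : Module.Projective R M := by
  obtain ⟨s, hs⟩ := Module.projective_def'.1 (inferInstance : Module.Projective A M)
  have hF := finsupp_smul_eq φ hA M
  have := projective_finsupp (R := R) (A := A) M
  exact Module.Projective.of_split (restrictAlong φ hM hF s)
    (restrictAlong φ hF hM (Finsupp.linearCombination A id))
    (LinearMap.ext fun x => LinearMap.congr_fun hs x)

theorem finite_of_ringHom {M : Type u} [AddCommGroup M] [Module R M] [Module A M]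
    (hφ : Function.Surjective φ) (hM : ∀ (r : R) (x : M), r • x = φ r • x)
    [hfin : Module.Finite A M] : Module.Finite R M := by
  obtain ⟨s, hs⟩ := hfin.fg_top
  refine ⟨s, eq_top_iff.2 fun x _ => ?_⟩
  have hx : x ∈ Submodule.span A (s : Set M) := hs ▸ Submodule.mem_top
  induction hx using Submodule.span_induction with
  | mem x h => exact Submodule.subset_span h
  | zero => exact zero_mem _
  | add x y _ _ hx hy => exact add_mem (hx trivial) (hy trivial)
  | smul a x _ hx =>
    obtain ⟨r, rfl⟩ := hφ a
    rw [← hM]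
    exact Submodule.smul_mem _ _ (hx trivial)

theorem fgpdLE_of_ringHom (hφ : Function.Surjective φ) [Module R A] [Module.Projective R A]
    (hA : ∀ (r : R) (a : A), r • a = φ r * a)
    {n : ℕ} {M : Type u} [AddCommGroup M] [Module R M] [Module A M]
    (hM : ∀ (r : R) (x : M), r • x = φ r • x) (h : fgpdLE A n M) : fgpdLE R n M := by
  induction n generalizing M with
  | zero =>
    obtain ⟨_, _⟩ := h
    exact ⟨projective_of_ringHom φ hA hM, finite_of_ringHom φ hφ hM⟩
  | succ n ih =>
    obtain ⟨P, _, _, ⟨_, _⟩, f, hf, hk⟩ := h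
    let _ := Module.compHom P φ
    have hP : ∀ (r : R) (x : P), r • x = φ r • x := fun _ _ => rfl
    refine ⟨P, _, _, ⟨projective_of_ringHom φ hA hP, finite_of_ringHom φ hφ hP⟩,
      restrictAlong φ hP hM f, hf, ?_⟩
    let _ : Module A (LinearMap.ker (restrictAlong φ hP hM f)) :=
      inferInstanceAs (Module A (LinearMap.ker f))
    exact ih (M := LinearMap.ker (restrictAlong φ hP hM f)) (fun r x => Subtype.ext (hP r x.1)) hk

theorem pdLE_of_ringHom (hφ : Function.Surjective φ) [Module R A] [Module.Projective R A]
    (hA : ∀ (r : R) (a : A), r • a = φ r * a)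
    {n : ℕ} {M : Type u} [AddCommGroup M] [Module R M] [Module A M]
    (hM : ∀ (r : R) (x : M), r • x = φ r • x) (h : pdLE R n M) : pdLE A n M := by
  induction n generalizing M with
  | zero =>
    have : Module.Projective R M := h
    have hF := finsupp_smul_eq φ hA M
    obtain ⟨s, hs⟩ := Module.projective_lifting_property
      (restrictAlong φ hF hM (Finsupp.linearCombination A id)) LinearMap.id
      (Finsupp.linearCombination_id_surjective A M)
    let t : M →ₗ[A] (M →₀ A) :=
      { toFun := s
        map_add' := map_add s
        map_smul' := fun a x => by
          obtain ⟨r, rfl⟩ := hφ a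
          rw [← hM, map_smul, hF, RingHom.id_apply] }
    exact Module.Projective.of_split t (Finsupp.linearCombination A id)
      (LinearMap.ext fun x => LinearMap.congr_fun hs x)
  | succ n ih =>
    have hF := finsupp_smul_eq φ hA M
    let f : (M →₀ A) →ₗ[A] M := Finsupp.linearCombination A id
    have hf : Function.Surjective f := Finsupp.linearCombination_id_surjective A M
    have := projective_finsupp (R := R) (A := A) M
    have hk := pdLE_ker (restrictAlong φ hF hM f) hf h
    let _ : Module A (LinearMap.ker (restrictAlong φ hF hM f)) :=
      (inferInstance : Module A (LinearMap.ker f))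
    exact ⟨M →₀ A, _, _, inferInstance, f, hf,
      ih (M := LinearMap.ker (restrictAlong φ hF hM f)) (fun r x => Subtype.ext (hF r x.1)) hk⟩

end RestrictScalars

open IsLocalRing CategoryTheory in
theorem projectiveDimension_residue_le (R : Type u) [CommRing R] [IsNoetherianRing R]
    (p : Ideal R) [p.IsPrime] :
    projectiveDimension (ModuleCat.of (Localization.AtPrime p)
      (Localization.AtPrime p ⧸ maximalIdeal (Localization.AtPrime p))) ≤
    projectiveDimension (ModuleCat.of R (R ⧸ p)) := by
  refine le_trans (le_of_eq ?_)
    (ModuleCat.projectiveDimension_le_projectiveDimension_of_isLocalizedModule p.primeCompl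
      (ModuleCat.of R (R ⧸ p)))
  let f := Algebra.linearMap R (Localization.AtPrime p)
  have hp : Submodule.localized' (Localization.AtPrime p) p.primeCompl f p =
      maximalIdeal (Localization.AtPrime p) := by
    rw [← Localization.AtPrime.map_eq_maximalIdeal]
    exact Ideal.localized'_eq_map _ _ _
  have := ModuleCat.localizedModule_isLocalizedModule (ModuleCat.of R (R ⧸ p)) p.primeCompl
  let e₁ := IsLocalizedModule.linearEquiv p.primeCompl
    (Submodule.toLocalizedQuotient' (Localization.AtPrime p) p.primeCompl f p)
    ((ModuleCat.of R (R ⧸ p)).localizedModuleMkLinearMap p.primeCompl)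
  let e₂ := e₁.extendScalarsOfIsLocalization p.primeCompl (Localization.AtPrime p)
  exact ModuleCat.projectiveDimension_eq_of_linearEquiv
    ((Submodule.quotEquivOfEq _ _ hp.symm).trans e₂)

open IsLocalRing CategoryTheory in
/-- If no prime lies strictly between `q` and the maximal ideal, any module annihilated by `q`
and by an element outside `q` is filtered by copies of the residue field. -/
theorem hasProjectiveDimensionLT_of_annihilator {R : Type u} [CommRing R] [IsNoetherianRing R]
    [IsLocalRing R] {q : Ideal R} {x : R} (hxq : x ∉ q)
    (hq : ∀ q' : Ideal R, q'.IsPrime → q < q' → ¬ q' < maximalIdeal R)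
    {k : ℕ} (hk : HasProjectiveDimensionLT (ModuleCat.of R (R ⧸ maximalIdeal R)) k)
    (M : Type u) [AddCommGroup M] [Module R M] [hM : Module.Finite R M]
    (hqM : q ≤ Module.annihilator R M) (hxM : x ∈ Module.annihilator R M) :
    HasProjectiveDimensionLT (ModuleCat.of R M) k := by
  induction hM using IsNoetherianRing.induction_on_isQuotientEquivQuotientPrime with
  | subsingleton N =>
    have := (hasProjectiveDimensionLT_zero_iff_isZero (X := ModuleCat.of R N)).2
      (ModuleCat.isZero_of_subsingleton _)
    exact hasProjectiveDimensionLT_of_ge _ 0 k (Nat.zero_le k)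
  | quotient N p e =>
    rw [e.annihilator_eq, Ideal.annihilator_quotient] at hqM hxM
    have hlt : q < p.1 := lt_of_le_of_ne hqM fun h => hxq (h ▸ hxM)
    have hpm : p.1 = maximalIdeal R := by
      by_contra hne
      exact hq p.1 p.2 hlt (lt_of_le_of_ne (le_maximalIdeal p.2.ne_top) hne)
    rw [← projectiveDimension_lt_iff] at hk ⊢
    rwa [ModuleCat.projectiveDimension_eq_of_linearEquiv (M := ModuleCat.of R N)
      (N := ModuleCat.of R (R ⧸ maximalIdeal R)) (e.trans (Submodule.quotEquivOfEq _ _ hpm))]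
  | exact N₁ N₂ N₃ f g hf hg hfg h₁ h₃ =>
    have hS : (ShortComplex.mk (ModuleCat.ofHom f) (ModuleCat.ofHom g)
        (by ext y; exact hfg.apply_apply_eq_zero y)).ShortExact :=
      { exact := (ShortComplex.ShortExact.moduleCat_exact_iff_function_exact _).2 hfg
        mono_f := (ModuleCat.mono_iff_injective _).2 hf
        epi_g := (ModuleCat.epi_iff_surjective _).2 hg }
    have a₁ := f.annihilator_le_of_injective hf
    have a₃ := g.annihilator_le_of_surjective hg
    exact hS.hasProjectiveDimensionLT_X₂ k (h₁ (hqM.trans a₁) (a₁ hxM))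
      (h₃ (hqM.trans a₃) (a₃ hxM))

open IsLocalRing CategoryTheory in
theorem height_le_projectiveDimension (n : ℕ) (R : Type u) [CommRing R] [IsNoetherianRing R]
    (p : Ideal R) [hp : p.IsPrime] (h : (n : ℕ∞) ≤ p.height) :
    ((n : ℕ∞) : WithBot ℕ∞) ≤ projectiveDimension (ModuleCat.of R (R ⧸ p)) := by
  induction n generalizing R with
  | zero =>
    refine (projectiveDimension_ge_iff _ 0).2 fun h0 => ?_
    rw [hasProjectiveDimensionLT_zero_iff_isZero, ModuleCat.isZero_iff_subsingleton] at h0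
    exact not_subsingleton (R ⧸ p) h0
  | succ n ih =>
    refine le_trans ?_ (projectiveDimension_residue_le R p)
    let B := Localization.AtPrime p
    have hB : ((n + 1 : ℕ) : ℕ∞) ≤ (maximalIdeal B).height := by
      rwa [← IsLocalization.height_under p.primeCompl (maximalIdeal B),
        show (maximalIdeal B).under R = p from Localization.AtPrime.under_maximalIdeal]
    have hB' : ¬ (maximalIdeal B).height ≤ n := fun h' => by
      have := hB.trans h'
      norm_cast at this
      lia
    rw [Ideal.height_le_iff_covBy] at hB'
    push Not at hB'
    obtain ⟨q, hqp, hqm, hq, hqn⟩ := hB'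
    obtain ⟨x, hxm, hxq⟩ := SetLike.exists_of_lt hqm
    have hreg : IsSMulRegular (B ⧸ q) x :=
      (isSMulRegular_quotient_iff_mem_of_smul_mem _ _).2 fun y hy =>
        (hqp.mem_or_mem hy).resolve_left hxq
    refine (projectiveDimension_ge_iff _ _).2 fun hk => ?_
    have hlt := hasProjectiveDimensionLT_of_annihilator hxq (fun q' h1 h2 h3 => hq q' h1 h2 h3) hk
      (QuotSMulTop x (B ⧸ q))
      (fun r hr => Module.mem_annihilator.2 fun y => by
        obtain ⟨y, rfl⟩ := Submodule.Quotient.mk_surjective _ y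
        obtain ⟨y, rfl⟩ := Ideal.Quotient.mk_surjective y
        rw [← Submodule.Quotient.mk_smul]
        have : r • (Ideal.Quotient.mk q y) = 0 := by
          rw [← Ideal.Quotient.mkₐ_eq_mk B, ← map_smul, Ideal.Quotient.mkₐ_eq_mk,
            Ideal.Quotient.eq_zero_iff_mem]
          exact q.mul_mem_right _ hr
        rw [this, Submodule.Quotient.mk_zero])
      (Module.mem_annihilator.2 fun y => by
        obtain ⟨y, rfl⟩ := Submodule.Quotient.mk_surjective _ y
        rw [← Submodule.Quotient.mk_smul, Submodule.Quotient.mk_eq_zero]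
        exact Submodule.smul_mem_pointwise_smul _ _ _ trivial)
    rw [← projectiveDimension_lt_iff,
      ModuleCat.projectiveDimension_quotSMulTop_eq_succ_of_isSMulRegular
        (ModuleCat.of B (B ⧸ q)) x hreg hxm] at hlt
    have := ih B q hqn
    refine absurd hlt (not_lt.2 ?_)
    push_cast
    exact add_le_add_left this 1

theorem exists_not_pdLE (A : Type u) [CommRing A] [IsNoetherianRing A]
    (hdim : ringKrullDim A = ⊤) (n : ℕ) : ∃ p : Ideal A, ¬ pdLE A n (A ⧸ p) := by
  by_contra! hcon
  have : ringKrullDim A ≤ ((n : ℕ∞) : WithBot ℕ∞) :=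
    (ringKrullDim_le_iff_height_le _).2 fun p hp => by
      by_contra! hlt
      have h1 : ((n + 1 : ℕ) : ℕ∞) ≤ p.height := by
        push_cast
        exact Order.add_one_le_of_lt (by exact_mod_cast hlt)
      have h2 := (CategoryTheory.projectiveDimension_ge_iff _ (n + 1)).1
        (height_le_projectiveDimension (n + 1) A p h1)
      exact h2 ((pdLE_iff_hasProjectiveDimensionLE A n _).1 (hcon p))
  rw [hdim, top_le_iff] at this
  exact absurd (WithBot.coe_eq_top.1 this) (ENat.natCast_ne_top n)

/-- The projection of a triangular matrix ring onto its commutative upper left corner, as a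
ring homomorphism on the opposite ring. -/
def Tri.opFst (A B M : Type u) [CommRing A] [Ring B] [AddCommGroup M]
    [Module B M] [Module Aᵐᵒᵖ M] [SMulCommClass B Aᵐᵒᵖ M] : (Tri A B M)ᵐᵒᵖ →+* A where
  toFun x := (unop x).a
  map_one' := rfl
  map_mul' x y := mul_comm _ _
  map_zero' := rfl
  map_add' _ _ := rfl

theorem Tri.opFst_surjective (A B M : Type u) [CommRing A] [Ring B] [AddCommGroup M]
    [Module B M] [Module Aᵐᵒᵖ M] [SMulCommClass B Aᵐᵒᵖ M] :
    Function.Surjective (Tri.opFst A B M) :=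
  fun a => ⟨op ⟨a, 0, 0⟩, rfl⟩

theorem Tri.projective_opFst (A B M : Type u) [CommRing A] [Ring B] [AddCommGroup M]
    [Module B M] [Module Aᵐᵒᵖ M] [SMulCommClass B Aᵐᵒᵖ M] :
    letI := Module.compHom A (Tri.opFst A B M)
    Module.Projective (Tri A B M)ᵐᵒᵖ A := by
  let _ := Module.compHom A (Tri.opFst A B M)
  let i : A →ₗ[(Tri A B M)ᵐᵒᵖ] (Tri A B M)ᵐᵒᵖ :=
    { toFun := fun a => op ⟨a, 0, 0⟩
      map_add' := fun x y => unop_injective (by ext <;> simp)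
      map_smul' := fun r x => unop_injective (by
        ext
        · exact mul_comm _ _
        · simp
        · simp) }
  let π : (Tri A B M)ᵐᵒᵖ →ₗ[(Tri A B M)ᵐᵒᵖ] A :=
    { toFun := Tri.opFst A B M
      map_add' := map_add _
      map_smul' := fun r x => map_mul _ r x }
  exact Module.Projective.of_split i π rfl

theorem Tri.finDim_eq_top (A B M : Type u) [CommRing A] [IsNoetherianRing A] [Ring B]
    [AddCommGroup M] [Module B M] [Module Aᵐᵒᵖ M] [SMulCommClass B Aᵐᵒᵖ M]
    (hreg : ∀ (M : Type u) (_ : AddCommGroup M) (_ : Module A M),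
      Module.Finite A M → projDim A M ≠ ⊤)
    (hdim : ringKrullDim A = ⊤) : finDim (Tri A B M) = ⊤ := by
  let φ := Tri.opFst A B M
  have hφ : Function.Surjective φ := Tri.opFst_surjective A B M
  let _ := Module.compHom A φ
  have : Module.Projective (Tri A B M)ᵐᵒᵖ A := Tri.projective_opFst A B M
  refine ENat.eq_top_iff_forall_ge.2 fun n => ?_
  obtain ⟨p, hp⟩ := exists_not_pdLE A hdim n
  obtain ⟨k, hk⟩ := exists_pdLE_of_projDim_ne_top (hreg (A ⧸ p) _ _ inferInstance)
  let _ : Module (Tri A B M)ᵐᵒᵖ (A ⧸ p) := Module.compHom (A ⧸ p) φ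
  have hfg : fgpdLE (Tri A B M)ᵐᵒᵖ k (A ⧸ p) :=
    fgpdLE_of_ringHom φ hφ (fun _ _ => rfl) (fun _ _ => rfl) (fgpdLE_of_pdLE hk)
  have hlt : (n : ℕ∞) ≤ projDim (Tri A B M)ᵐᵒᵖ (A ⧸ p) := by
    by_contra! hlt
    exact hp (pdLE_of_ringHom φ hφ (fun _ _ => rfl) (fun _ _ => rfl) (projDim_le_iff.1 hlt.le))
  exact hlt.trans (le_sSup ⟨A ⧸ p, _, _, ⟨k, hfg⟩, rfl⟩)

section Bass

/-- Every injection from `P` into a finitely generated projective module splits. -/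
def InjectionsSplit (R : Type u) [Ring R] (P : Type u) [AddCommGroup P] [Module R P] : Prop :=
  ∀ (Q : Type u) [AddCommGroup Q] [Module R Q] [Module.Projective R Q] [Module.Finite R Q]
    (f : P →ₗ[R] Q), Function.Injective f → ∃ g : Q →ₗ[R] P, g ∘ₗ f = LinearMap.id

variable {R : Type u} [Ring R]

theorem injectionsSplit_self
    (hB : ∀ (k : ℕ) (x : Fin k → R),
      (∃ y : Fin k → R, ∑ i, x i * y i = 1) ∨ ∃ r ≠ 0, ∀ i, r * x i = 0) :
    InjectionsSplit R R := by
  intro Q _ _ _ _ f hf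
  obtain ⟨k, t, s, -, -, hts⟩ := Module.Finite.exists_comp_eq_id_of_projective R Q
  rcases hB k (s (f 1)) with ⟨y, hy⟩ | ⟨r, hr, hrx⟩
  · refine ⟨{ toFun := fun v => ∑ i, s v i * y i, map_add' := ?_, map_smul' := ?_ }, ?_⟩
    · intro v w
      simp [add_mul, Finset.sum_add_distrib]
    · intro r v
      simp [mul_assoc, Finset.mul_sum]
    · ext
      simpa using hy
  · refine absurd (hf ?_) hr
    have h0 : s (f r) = 0 := by
      rw [← mul_one r, ← smul_eq_mul, map_smul, map_smul]
      exact funext hrx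
    rw [map_zero, ← LinearMap.id_apply (R := R) (f r), ← hts, LinearMap.comp_apply, h0, map_zero]

theorem InjectionsSplit.prod {P₁ P₂ : Type u} [AddCommGroup P₁] [Module R P₁] [AddCommGroup P₂]
    [Module R P₂] (h₁ : InjectionsSplit R P₁) (h₂ : InjectionsSplit R P₂) :
    InjectionsSplit R (P₁ × P₂) := by
  intro Q _ _ _ _ f hf
  let f₁ := f ∘ₗ LinearMap.inl R P₁ P₂
  let f₂ := f ∘ₗ LinearMap.inr R P₁ P₂
  obtain ⟨g₁, hg₁⟩ := h₁ Q f₁ (hf.comp LinearMap.inl_injective)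
  have hg₁' : ∀ x, g₁ (f₁ x) = x := LinearMap.congr_fun hg₁
  let π : Q →ₗ[R] LinearMap.ker g₁ :=
    (LinearMap.id - f₁ ∘ₗ g₁).codRestrict _ fun v => by simp [hg₁']
  have hπ : ∀ v, (π v : Q) = v - f₁ (g₁ v) := fun _ => rfl
  have hπs : π ∘ₗ (LinearMap.ker g₁).subtype = LinearMap.id := by
    ext v
    simp [hπ]
  have : Module.Projective R (LinearMap.ker g₁) := Module.Projective.of_split _ _ hπs
  have : Module.Finite R (LinearMap.ker g₁) :=
    Module.Finite.of_surjective π (LinearMap.surjective_of_comp_eq_id _ _ hπs)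
  have hf' : ∀ x y, f (x, y) = f₁ x + f₂ y := fun x y => by simp [f₁, f₂, ← map_add]
  obtain ⟨g₂, hg₂⟩ := h₂ _ (π ∘ₗ f₂) (by
    rw [← LinearMap.ker_eq_bot, LinearMap.ker_eq_bot']
    intro y hy
    have h0 : f₂ y - f₁ (g₁ (f₂ y)) = 0 := by
      rw [← hπ]
      exact congrArg Subtype.val hy
    have : f (-g₁ (f₂ y), y) = f 0 := by
      rw [hf', map_neg, map_zero, neg_add_eq_sub, h0]
    exact congrArg Prod.snd (hf this))
  have hg₂' : ∀ y, g₂ (π (f₂ y)) = y := LinearMap.congr_fun hg₂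
  have hπf₁ : ∀ x, π (f₁ x) = 0 := fun x => Subtype.ext (by simp [hπ, hg₁'])
  refine ⟨(g₁ - g₁ ∘ₗ f₂ ∘ₗ g₂ ∘ₗ π).prod (g₂ ∘ₗ π), LinearMap.ext fun ⟨x, y⟩ => ?_⟩
  simp [hf', hg₁', hg₂', hπf₁]

theorem InjectionsSplit.of_split {P F : Type u} [AddCommGroup P] [Module R P] [AddCommGroup F]
    [Module R F] [Module.Projective R F] [Module.Finite R F] (hF : InjectionsSplit R F)
    (s : P →ₗ[R] F) (t : F →ₗ[R] P) (hts : t ∘ₗ s = LinearMap.id) : InjectionsSplit R P := by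
  intro Q _ _ _ _ f hf
  have hts' : ∀ x, t (s x) = x := LinearMap.congr_fun hts
  obtain ⟨h, hh⟩ := hF (Q × F) ((f ∘ₗ t).prod (LinearMap.id - s ∘ₗ t)) (by
    rw [← LinearMap.ker_eq_bot, LinearMap.ker_eq_bot']
    intro v hv
    have h1 : t v = 0 := hf ((congrArg Prod.fst hv).trans (map_zero f).symm)
    simpa [h1] using congrArg Prod.snd hv)
  refine ⟨t ∘ₗ h ∘ₗ LinearMap.inl R Q F, LinearMap.ext fun x => ?_⟩
  have := LinearMap.congr_fun hh (s x)
  simp only [LinearMap.comp_apply, LinearMap.prod_apply, Function.prod_apply, hts',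
    LinearMap.sub_apply, LinearMap.id_apply, sub_self] at this
  simp [this, hts']

theorem injectionsSplit_of_finite_projective (hR : InjectionsSplit R R)
    (P : Type u) [AddCommGroup P] [Module R P] [Module.Projective R P] [Module.Finite R P] :
    InjectionsSplit R P := by
  have hfree : ∀ n : ℕ, InjectionsSplit R (Fin n → R) := fun n => by
    induction n with
    | zero => exact fun Q _ _ _ _ f _ => ⟨0, LinearMap.ext fun x => Subsingleton.elim _ _⟩
    | succ n ih =>
      let e := Fin.consLinearEquiv R (fun _ : Fin (n + 1) => R)
      exact (hR.prod ih).of_split e.symm.toLinearMap e.toLinearMap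
        (LinearMap.ext e.apply_symm_apply)
  obtain ⟨k, t, s, -, -, hts⟩ := Module.Finite.exists_comp_eq_id_of_projective R P
  exact (hfree k).of_split s t hts

theorem projective_of_fgpdLE (hR : InjectionsSplit R R) {n : ℕ} {M : Type u} [AddCommGroup M]
    [Module R M] (h : fgpdLE R n M) : Module.Projective R M := by
  induction n generalizing M with
  | zero => exact h.1
  | succ n ih =>
    obtain ⟨P, _, _, ⟨_, _⟩, f, hf, hk⟩ := h
    have := ih hk
    have := hk.finite
    have hsplit := injectionsSplit_of_finite_projective hR (LinearMap.ker f) P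
      (LinearMap.ker f).subtype (LinearMap.ker f).injective_subtype
    have hex : Function.Exact (LinearMap.ker f).subtype f := LinearMap.exact_subtype_ker_map f
    obtain ⟨l, hl⟩ := ((hex.split_tfae (LinearMap.ker f).injective_subtype hf).out 1 0).1 hsplit
    exact Module.Projective.of_split l f hl

theorem smallFinDimLeft_eq_zero
    (hB : ∀ (k : ℕ) (x : Fin k → R),
      (∃ y : Fin k → R, ∑ i, x i * y i = 1) ∨ ∃ r ≠ 0, ∀ i, r * x i = 0) :
    smallFinDimLeft R = 0 := by
  refine le_antisymm (sSup_le ?_) zero_le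
  rintro _ ⟨M, _, _, ⟨n, hn⟩, rfl⟩
  exact (projDim_le_iff (n := 0)).2 (projective_of_fgpdLE (injectionsSplit_self hB) hn)

end Bass

section BassAsymCover

variable {A : Type u} [CommRing A] {ι : Type u} (S : ι → Type u)
  [∀ i, AddCommGroup (S i)] [∀ i, Module Aᵐᵒᵖ (S i)]

theorem exists_mul_eq_one_of_fst_ne_zero {i : ι} (hS : IsSimpleModule Aᵐᵒᵖ (S i))
    (b : TrivSqZeroExt (EndS A S i) (EndS A S i)) (hb : b.fst ≠ 0) : ∃ v, b * v = 1 := by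
  obtain ⟨d, hd⟩ :=
    ((Module.End.isUnit_iff _).2 (LinearMap.bijective_of_ne_zero hb)).exists_right_inv
  refine ⟨TrivSqZeroExt.inl d - TrivSqZeroExt.inr (d * (b.snd * d)), ?_⟩
  refine TrivSqZeroExt.ext ?_ ?_
  · simpa using hd
  · simp only [TrivSqZeroExt.snd_mul, TrivSqZeroExt.snd_sub, TrivSqZeroExt.fst_sub,
      TrivSqZeroExt.fst_inl, TrivSqZeroExt.snd_inl, TrivSqZeroExt.fst_inr, TrivSqZeroExt.snd_inr,
      TrivSqZeroExt.snd_one, sub_zero, zero_sub, smul_eq_mul, MulOpposite.smul_eq_mul_unop,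
      unop_op, mul_neg]
    rw [← mul_assoc, hd, one_mul, neg_add_cancel]

theorem exists_simple_annihilated (hfam : IsSimpleFamily A S) {I : Ideal A} (hI : I ≠ ⊤) :
    ∃ (i : ι) (s : S i), s ≠ 0 ∧ ∀ a ∈ I, op a • s = 0 := by
  obtain ⟨m, hm, hIm⟩ := I.exists_le_maximal hI
  let φ : Aᵐᵒᵖ →+* A := (RingEquiv.toOpposite A).symm.toRingHom
  have : RingHomSurjective φ := ⟨(RingEquiv.toOpposite A).symm.surjective⟩
  let l : (A ⧸ m) →ₛₗ[φ] (A ⧸ m) :=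
    { toFun := id
      map_add' := fun _ _ => rfl
      map_smul' := fun r y => by
        obtain ⟨y, rfl⟩ := Ideal.Quotient.mk_surjective y
        exact congrArg (Ideal.Quotient.mk m) (mul_comm y (unop r)) }
  have hs : IsSimpleModule A (A ⧸ m) := isSimpleModule_iff_isCoatom.2 hm.out
  have hs' : IsSimpleModule Aᵐᵒᵖ (A ⧸ m) :=
    (l.isSimpleModule_iff_of_bijective Function.bijective_id).2 hs
  obtain ⟨i, ⟨e⟩⟩ := hfam.2.1 (A ⧸ m) _ _ hs'
  refine ⟨i, e 1, fun h => one_ne_zero (e.map_eq_zero_iff.1 h), fun a ha => ?_⟩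
  rw [← map_smul, e.map_eq_zero_iff]
  change Ideal.Quotient.mk m (1 * a) = 0
  rw [one_mul]
  exact Ideal.Quotient.eq_zero_iff_mem.2 (hIm ha)

theorem asymCover_left_annihilator_of_fst_eq_zero (hS : ∀ i, IsSimpleModule Aᵐᵒᵖ (S i)) {i : ι} :
    ∃ r : AsymCover A S, r ≠ 0 ∧ ∀ x : AsymCover A S, (x.b i).fst = 0 → r * x = 0 := by
  classical
  have := hS i
  have := IsSimpleModule.nontrivial Aᵐᵒᵖ (S i)
  refine ⟨⟨0, 0, Pi.single i (TrivSqZeroExt.inr 1)⟩, fun h => ?_, fun x hx => ?_⟩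
  · have h1 : (Pi.single i (TrivSqZeroExt.inr 1) : Abar A S) i = 0 :=
      congrFun (congrArg Tri.b h) i
    rw [Pi.single_eq_same] at h1
    exact one_ne_zero (congrArg TrivSqZeroExt.snd h1 : (1 : EndS A S i) = 0)
  · refine Tri.ext (zero_mul _) ?_ (funext fun j => ?_)
    · simp only [Tri.mul_m, smul_zero, zero_add, Tri.zero_m]
      refine DFinsupp.ext fun j => ?_
      rw [DirectSum.smul_apply, abar_smul_def]
      obtain rfl | hj := eq_or_ne j i
      · rw [Pi.single_eq_same]
        rfl
      · rw [Pi.single_eq_of_ne hj]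
        rfl
    · change (Pi.single i (TrivSqZeroExt.inr 1) : Abar A S) j * x.b j = 0
      obtain rfl | hj := eq_or_ne j i
      · rw [Pi.single_eq_same]
        refine TrivSqZeroExt.ext ?_ ?_
        · simp
        · simp [hx]
      · rw [Pi.single_eq_of_ne hj, zero_mul]

theorem asymCover_left_annihilator_of_ideal_ne_top (hfam : IsSimpleFamily A S) {I : Ideal A}
    (hI : I ≠ ⊤) :
    ∃ r : AsymCover A S, r ≠ 0 ∧ ∀ x : AsymCover A S, x.a ∈ I → r * x = 0 := by
  classical
  obtain ⟨i, s, hs, hsI⟩ := exists_simple_annihilated S hfam hI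
  refine ⟨⟨0, DirectSum.lof Aᵐᵒᵖ ι S i s, 0⟩, fun h => hs ?_, fun x hx => ?_⟩
  · exact DirectSum.of_injective i ((congrArg Tri.m h).trans (map_zero (DirectSum.of S i)).symm)
  · refine Tri.ext (zero_mul _) ?_ (zero_mul _)
    simp only [Tri.mul_m, zero_smul, add_zero, Tri.zero_m]
    rw [← map_smul, hsI _ hx, map_zero]

theorem asymCover_bass (hfam : IsSimpleFamily A S) (k : ℕ) (x : Fin k → AsymCover A S) :
    (∃ y : Fin k → AsymCover A S, ∑ i, x i * y i = 1) ∨ ∃ r ≠ 0, ∀ i, r * x i = 0 := by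
  classical
  by_cases hfst : ∃ i, ∀ j, ((x j).b i).fst = 0
  · obtain ⟨i, hi⟩ := hfst
    obtain ⟨r, hr, hrx⟩ := asymCover_left_annihilator_of_fst_eq_zero S hfam.1 (i := i)
    exact .inr ⟨r, hr, fun j => hrx _ (hi j)⟩
  by_cases htop : Ideal.span (Set.range fun j => (x j).a) = ⊤
  swap
  · obtain ⟨r, hr, hrx⟩ := asymCover_left_annihilator_of_ideal_ne_top S hfam htop
    exact .inr ⟨r, hr, fun j => hrx _ (Ideal.subset_span ⟨j, rfl⟩)⟩
  left
  push Not at hfst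
  choose κ hκ using hfst
  choose v hv using fun i => exists_mul_eq_one_of_fst_ne_zero S (hfam.1 i) _ (hκ i)
  let I : Submodule (AsymCover A S)ᵐᵒᵖ (AsymCover A S) := Submodule.span _ (Set.range x)
  have hx (j) : x j ∈ I := Submodule.subset_span ⟨j, rfl⟩
  have hmul {z : AsymCover A S} (hz : z ∈ I) (y : AsymCover A S) : z * y ∈ I :=
    I.smul_mem (op y) hz
  let inB : Abar A S →+ AsymCover A S :=
    { toFun := fun b => ⟨0, 0, b⟩
      map_zero' := rfl
      map_add' := fun _ _ => by ext1 <;> simp }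
  have hone : ∑ j, (x j).b * (fun i => if κ i = j then v i else 0) = 1 := by
    funext i
    simp [Finset.sum_apply, hv]
  have he : inB 1 ∈ I := by
    rw [← hone, map_sum]
    refine sum_mem fun j _ => ?_
    convert hmul (hx j) (inB fun i => if κ i = j then v i else 0) using 1
    ext1 <;> simp [inB]
  have hm (m : Sbar A S) (b : Abar A S) : (⟨0, m, b⟩ : AsymCover A S) ∈ I := by
    convert hmul he ⟨0, m, b⟩ using 1
    ext1 <;> simp [inB]
  have ha {z : AsymCover A S} (hz : z ∈ I) (a : A) : (⟨z.a * a, 0, 0⟩ : AsymCover A S) ∈ I := by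
    convert sub_mem (hmul hz ⟨a, 0, 0⟩) (hm (op a • z.m) 0) using 1
    rw [eq_sub_iff_add_eq]
    ext1 <;> simp
  let J : Ideal A :=
    { carrier := {a | (⟨a, 0, 0⟩ : AsymCover A S) ∈ I}
      zero_mem' := I.zero_mem
      add_mem' := fun {a b} h₁ h₂ => by
        change (⟨a + b, 0, 0⟩ : AsymCover A S) ∈ I
        convert I.add_mem h₁ h₂ using 1
        ext1 <;> simp
      smul_mem' := fun c a h => by
        change (⟨c * a, 0, 0⟩ : AsymCover A S) ∈ I
        rw [mul_comm]
        exact ha h c }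
  have hJ : (1 : A) ∈ J := by
    have hle : Ideal.span (Set.range fun j => (x j).a) ≤ J := Ideal.span_le.2 (by
      rintro _ ⟨j, rfl⟩
      have := ha (hx j) 1
      rwa [mul_one] at this)
    exact hle (htop ▸ Submodule.mem_top)
  have h1 : (1 : AsymCover A S) ∈ I := by
    convert add_mem (show (⟨1, 0, 0⟩ : AsymCover A S) ∈ I from hJ) he using 1
    ext1 <;> simp [inB]
  obtain ⟨c, hc⟩ := (Submodule.mem_span_range_iff_exists_fun _).1 h1
  exact ⟨fun j => unop (c j), hc⟩

end BassAsymCover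

theorem finDim_asymCover_op_eq_zero {A : Type u} [CommRing A] {ι : Type u} (S : ι → Type u)
    [∀ i, AddCommGroup (S i)] [∀ i, Module Aᵐᵒᵖ (S i)] (hfam : IsSimpleFamily A S) :
    finDim (AsymCover A S)ᵐᵒᵖ = 0 := by
  let e := RingEquiv.opOp (AsymCover A S)
  refine smallFinDimLeft_eq_zero fun k x => ?_
  rcases asymCover_bass S hfam k (fun i => e.symm (x i)) with ⟨y, hy⟩ | ⟨r, hr, hrx⟩
  · refine .inl ⟨fun i => e (y i), ?_⟩
    simpa using congrArg e hy
  · refine .inr ⟨e r, by simpa using hr, fun i => ?_⟩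
    simpa using congrArg e (hrx i)

/-- Let `A` be a commutative noetherian ring which is regular
(every finitely generated `A`-module has finite projective dimension) and of
infinite Krull dimension, and let `Ã = [[A,0],[S̄,Ā]]` be its asymmetric
cover.  Then `fin.dim Ã = ∞` and `fin.dim Ã^op = 0`. -/
theorem finDim_asymCover_of_regular_infinite_krullDim
    (A : Type u) [CommRing A] [IsNoetherianRing A]
    (hreg : ∀ (M : Type u) (_ : AddCommGroup M) (_ : Module A M),
      Module.Finite A M → projDim A M ≠ ⊤)
    (hdim : ringKrullDim A = ⊤)
    {ι : Type u} (S : ι → Type u)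
    [∀ i, AddCommGroup (S i)] [∀ i, Module Aᵐᵒᵖ (S i)]
    (hfam : IsSimpleFamily A S) :
    finDim (AsymCover A S) = ⊤ ∧ finDim (AsymCover A S)ᵐᵒᵖ = 0 := by
  exact ⟨Tri.finDim_eq_top A (Abar A S) (Sbar A S) hreg hdim, finDim_asymCover_op_eq_zero S hfam⟩
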